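/- An infinite word over the binary alphabet {a, b} is LSP if and only if it is {L_a, L_b}-adic (allowing also the restrictions of L_a and L_b to the single-letter subalphabets in the desubstitution steps). -/

import Mathlib

section LSPDefs

variable {A : Type*} {B : Type*}

/-- `u` is a prefix of the infinite word `w`. -/
def IsPrefixI (u : List A) (w : ℕ → A) : Prop :=
  ∀ (i : ℕ) (h : i < u.length), u.get ⟨i, h⟩ = w i

/-- `u` is a factor of the infinite word `w`. -/
def IsFactorI (u : List A) (w : ℕ → A) : Prop :=
  ∃ k : ℕ, ∀ (i : ℕ) (h : i < u.length), u.get ⟨i, h⟩ = w (k + i)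

/-- `u` is a left special factor of the infinite word `w`. -/
def LeftSpecialI (u : List A) (w : ℕ → A) : Prop :=
  ∃ a b : A, a ≠ b ∧ IsFactorI (a :: u) w ∧ IsFactorI (b :: u) w

/-- An infinite word is LSP if all its left special factors are prefixes of it. -/
def IsLSP (w : ℕ → A) : Prop :=
  ∀ u : List A, LeftSpecialI u w → IsPrefixI u w

/-- Application of a morphism (given by images of letters) to a finite word. -/
def applyM (f : A → List B) (u : List A) : List B := (u.map f).flatten

/-- The prefix of length `n` of an infinite word. -/
def infPrefix (w : ℕ → A) (n : ℕ) : List A := List.ofFn (fun i : Fin n => w i)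

/-- `x` is the image of the infinite word `w` under the morphism `f`. -/
def InfImage (f : A → List B) (w : ℕ → A) (x : ℕ → B) : Prop :=
  ∀ n : ℕ, IsPrefixI (applyM f (infPrefix w n)) x

/-- `f` is a basic LSP (bLSP) endomorphism. -/
def IsBLSP (f : A → List A) : Prop :=
  ∃ α : A, f α = [α] ∧ ∀ β : A, β ≠ α → ∃ γ : A, f β = f γ ++ [β]

/-- `f` is an R-bLSP morphism with domain alphabet `D`: the restriction to `D` of a
bLSP morphism `g` (letters outside the domain are sent to `[]`). -/
def IsRBLSPOn (D : Set A) (f : A → List A) : Prop :=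
  (∀ x : A, x ∈ D ↔ f x ≠ []) ∧ ∃ g : A → List A, IsBLSP g ∧ ∀ x ∈ D, f x = g x

/-- The episturmian morphism `L_α`. -/
def Lmor [DecidableEq A] (α : A) : A → List A := fun β => if β = α then [α] else [α, β]

/-- `u` is an `(a,b,c,β,γ)`-fragility of `w`. -/
def Frag5 (w : ℕ → A) (a b c β γ : A) (u : List A) : Prop :=
  IsPrefixI (u ++ [a]) w ∧ IsFactorI (β :: (u ++ [b])) w ∧ IsFactorI (γ :: (u ++ [c])) w

/-- `w` is `(a,b,c)`-fragile. -/
def Fragile (w : ℕ → A) (a b c : A) : Prop :=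
  ∃ (u : List A) (β γ : A), β ≠ γ ∧ Frag5 w a b c β γ u

/-- `f` is LSP `(a,b,c)`-breaking (for words over the domain `D` of `f`). -/
def Breaking (D : Set A) (f : A → List A) (a b c : A) : Prop :=
  ∀ (w x : ℕ → A), Set.range w ⊆ D → IsLSP w → Fragile w a b c →
    InfImage f w x → ¬ IsLSP x

/-- Length of the longest common prefix of two finite words. -/
noncomputable def lcpLen (u v : List A) : ℕ :=
  sSup {n | n ≤ u.length ∧ n ≤ v.length ∧ u.take n = v.take n}

/-- A morphism is nonerasing if images of letters are nonempty. -/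
def Nonerasing (f : A → List B) : Prop := ∀ a : A, f a ≠ []

/-- `f` preserves the LSP property for infinite words. -/
def PreservesLSP (f : A → List B) : Prop :=
  ∀ (w : ℕ → A) (x : ℕ → B), IsLSP w → InfImage f w x → IsLSP x

/-- `f ∈ U(A,B)`: nonerasing and each letter of `B` occurs at most once in total
among the images of letters. -/
def InU [Fintype A] [DecidableEq B] (f : A → List B) : Prop :=
  Nonerasing f ∧ ∀ b : B, (∑ a : A, (f a).count b) ≤ 1

/-- `u^k`. -/
def listPow (u : List B) (k : ℕ) : List B := (List.replicate k u).flatten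

/-- `x = u^ω`. -/
def IsOmegaPow (u : List B) (x : ℕ → B) : Prop := ∀ k : ℕ, IsPrefixI (listPow u k) x

/-- `f ∈ P_LSP(A,B)`: nonerasing, all images are positive powers of a word `u`
with `u^ω` LSP. -/
def InPLSP (f : A → List B) : Prop :=
  Nonerasing f ∧ ∃ u : List B, u ≠ [] ∧ (∀ a : A, ∃ k : ℕ, 0 < k ∧ f a = listPow u k) ∧
    ∀ x : ℕ → B, IsOmegaPow u x → IsLSP x

/-- `r` is the primitive root of `w`. -/
def IsPrimRoot (r w : List B) : Prop :=
  (∃ k : ℕ, 0 < k ∧ w = listPow r k) ∧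
  ∀ (v : List B) (k : ℕ), 0 < k → w = listPow v k → r.length ≤ v.length

/-- Compatibility of a chain of morphisms `[g_1, …, g_n]` (composition
`g_1 ∘ ⋯ ∘ g_n`): every letter produced by `g_{i+1}` lies in the domain of `g_i`. -/
def CompatChain (L : List (B → List B)) : Prop :=
  List.Chain' (fun g h => ∀ x y, y ∈ h x → g y ≠ []) L

end LSPDefs

def Good {A : Type*} (w : ℕ → A) (n : ℕ) : Prop :=
  ∀ i j, w i ≠ w j → (∀ k < n, w (i+1+k) = w (j+1+k)) → ∀ k < n, w (i+1+k) = w k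

lemma isLSP_iff_good {A : Type*} (w : ℕ → A) : IsLSP w ↔ ∀ n, Good w n := by
  constructor
  · intro h n i j hij hk k hkn
    have key := h (List.ofFn (fun k : Fin n => w (i+1+k))) ?_
    · have := key k (by simpa using hkn)
      simpa using this
    · refine ⟨w i, w j, hij, ⟨i, ?_⟩, ⟨j, ?_⟩⟩
      · intro q hq
        rcases q with _ | q
        · simp
        · simp; congr 1; omega
      · intro q hq
        rcases q with _ | q
        · simp
        · simp at hq
          simp
          rw [hk q hq]; congr 1; omega
  · rintro h u ⟨x, y, hxy, ⟨i, hi⟩, ⟨j, hj⟩⟩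
    have hi0 := hi 0 (by simp)
    have hj0 := hj 0 (by simp)
    simp at hi0 hj0
    have hi1 : ∀ k (hk : k < u.length), u.get ⟨k, hk⟩ = w (i+1+k) := by
      intro k hk
      have := hi (k+1) (by simpa using hk)
      rw [show i+1+k = i+(k+1) by omega, ← this]; simp
    have hj1 : ∀ k (hk : k < u.length), u.get ⟨k, hk⟩ = w (j+1+k) := by
      intro k hk
      have := hj (k+1) (by simpa using hk)
      rw [show j+1+k = j+(k+1) by omega, ← this]; simp
    intro k hk
    rw [hi1 k hk]
    refine h u.length i j (by rw [← hi0, ← hj0]; exact hxy) ?_ k hk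
    intro k hk
    rw [← hi1 k hk, ← hj1 k hk]

def LRel {A : Type*} [DecidableEq A] (α : A) (v w : ℕ → A) (p : ℕ → ℕ) : Prop :=
  p 0 = 0 ∧ ∀ n, w (p n) = α ∧ w (p n + 1) = v n ∧ p (n+1) = if v n = α then p n + 1 else p n + 2

lemma applyM_succ {A B : Type*} (f : A → List B) (v : ℕ → A) (n : ℕ) :
    applyM f (infPrefix v (n+1)) = applyM f (infPrefix v n) ++ f (v n) := by
  unfold applyM infPrefix
  rw [List.ofFn_succ_last]
  simp

lemma isPrefixI_append {A : Type*} (u v : List A) (w : ℕ → A) :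
    IsPrefixI (u ++ v) w ↔ IsPrefixI u w ∧ ∀ (i : ℕ) (h : i < v.length), v[i] = w (u.length + i) := by
  constructor
  · intro h
    constructor
    · intro i hi
      have := h i (by simp; omega)
      rw [← this]; simp [List.getElem_append_left, hi]
    · intro i hi
      have := h (u.length + i) (by simp; omega)
      rw [← this]; simp
  · rintro ⟨h1, h2⟩ i hi
    by_cases hu : i < u.length
    · rw [← h1 i hu]; simp [List.getElem_append_left, hu]
    · have := h2 (i - u.length) (by simp at hi; omega)
      rw [show u.length + (i - u.length) = i by omega] at this
      rw [← this]
      simp [List.getElem_append_right, Nat.le_of_not_lt hu]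

lemma infImage_iff {A : Type*} [DecidableEq A] (α : A) (v w : ℕ → A) :
    InfImage (Lmor α) v w ↔ ∃ p, LRel α v w p := by
  constructor
  · intro h
    have hp : ∀ n, (applyM (Lmor α) (infPrefix v (n+1))).length =
        if v n = α then (applyM (Lmor α) (infPrefix v n)).length + 1
        else (applyM (Lmor α) (infPrefix v n)).length + 2 := by
      intro n
      rw [applyM_succ]
      by_cases hv : v n = α <;> simp [Lmor, hv]
    have h1 : ∀ n, w (applyM (Lmor α) (infPrefix v n)).length = α := by
      intro n
      have := h (n+1)
      rw [applyM_succ, isPrefixI_append] at this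
      have := this.2 0 (by by_cases hv : v n = α <;> simp [Lmor, hv])
      by_cases hv : v n = α <;> simp [Lmor, hv] at this <;> exact this.symm
    refine ⟨fun n => (applyM (Lmor α) (infPrefix v n)).length, by simp [applyM, infPrefix], ?_⟩
    intro n
    refine ⟨h1 n, ?_, hp n⟩
    by_cases hv : v n = α
    · have h2 := h1 (n+1)
      rw [hp n, if_pos hv] at h2
      simp only [h2, hv]
    · have := h (n+1)
      rw [applyM_succ, isPrefixI_append] at this
      have := this.2 1 (by simp [Lmor, hv])
      simp [Lmor, hv] at this
      exact this.symm
  · rintro ⟨p, h0, hp⟩ n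
    have : IsPrefixI (applyM (Lmor α) (infPrefix v n)) w ∧
        (applyM (Lmor α) (infPrefix v n)).length = p n := by
      induction n with
      | zero =>
        refine ⟨?_, by simp [applyM, infPrefix, h0]⟩
        intro i hi
        simp [applyM, infPrefix] at hi
      | succ n ih =>
        obtain ⟨a1, a2, a3⟩ := hp n
        rw [applyM_succ, isPrefixI_append, List.length_append, ih.2, a3]
        by_cases hv : v n = α
        · simp only [Lmor, hv, if_true]
          refine ⟨⟨ih.1, ?_⟩, by simp⟩
          intro i hi
          simp at hi
          subst hi
          simpa using a1.symm
        · simp only [Lmor, hv, if_false]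
          refine ⟨⟨ih.1, ?_⟩, by simp⟩
          intro i hi
          simp at hi
          have : i = 0 ∨ i = 1 := by omega
          rcases this with rfl | rfl
          · simpa using a1.symm
          · simpa using a2.symm
    exact this.1

section
variable {A : Type*} [DecidableEq A] {α : A} {v w : ℕ → A} {p : ℕ → ℕ}

lemma LRel.lt (h : LRel α v w p) (n : ℕ) : p n < p (n+1) := by
  rw [(h.2 n).2.2]; split_ifs <;> omega

lemma LRel.mono (h : LRel α v w p) : StrictMono p := strictMono_nat_of_lt_succ h.lt

lemma LRel.add_le (h : LRel α v w p) (s m : ℕ) : p s + m ≤ p (s+m) := by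
  induction m with
  | zero => simp
  | succ m ih => have := h.lt (s+m); rw [show s+(m+1) = s+m+1 by omega]; omega

lemma LRel.pred (h : LRel α v w p) (s i : ℕ) (hi : p (s+1) = i + 1) : w i = v s := by
  obtain ⟨a1, a2, a3⟩ := h.2 s
  split_ifs at a3 with hv
  · rw [hv, ← a1]; congr 1; omega
  · rw [← a2]; congr 1; omega

lemma LRel.cover (h : LRel α v w p) (i : ℕ) : (∃ n, i = p n) ∨ ∃ n, i = p n + 1 ∧ v n ≠ α := by
  induction i with
  | zero => exact Or.inl ⟨0, h.1.symm⟩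
  | succ i ih =>
    rcases ih with ⟨n, hn⟩ | ⟨n, hn, hv⟩
    · by_cases hv : v n = α
      · left; refine ⟨n+1, ?_⟩
        rw [(h.2 n).2.2, if_pos hv, hn]
      · right; exact ⟨n, by omega, hv⟩
    · left; refine ⟨n+1, ?_⟩
      rw [(h.2 n).2.2, if_neg hv, hn]

lemma LRel.sync (h : LRel α v w p) (s t N : ℕ) (hN : ∀ k < N, w (p s + k) = w (p t + k)) (q : ℕ)
    (hq : p (s+q) + 1 < p s + N) : p (s+q) + p t = p (t+q) + p s ∧ v (s+q) = v (t+q) := by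
  induction q with
  | zero =>
    refine ⟨by simp; omega, ?_⟩
    simp at hq ⊢
    rw [← (h.2 s).2.1, ← (h.2 t).2.1]
    exact hN 1 (by omega)
  | succ q ih =>
    have hl := h.lt (s+q)
    rw [show s+(q+1) = s+q+1 by omega] at *
    rw [show t+(q+1) = t+q+1 by omega] at *
    obtain ⟨e1, e2⟩ := ih (by omega)
    have e3 : p (s+q+1) + p t = p (t+q+1) + p s := by
      rw [(h.2 (s+q)).2.2, (h.2 (t+q)).2.2, e2]
      split_ifs <;> omega
    refine ⟨e3, ?_⟩
    rw [← (h.2 (s+q+1)).2.1, ← (h.2 (t+q+1)).2.1]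
    have hle := h.add_le s (q+1)
    rw [show s+(q+1) = s+q+1 by omega] at *
    have := hN (p (s+q+1) + 1 - p s) (by omega)
    convert this using 2 <;> omega

lemma LRel.conv (h : LRel α v w p) (s t n : ℕ) (hn : ∀ k < n, v (s+k) = v (t+k)) :
    p (s+n) + p t = p (t+n) + p s ∧ ∀ k, p s + k ≤ p (s+n) → w (p s + k) = w (p t + k) := by
  induction n with
  | zero =>
    refine ⟨by simp; omega, ?_⟩
    intro k hk
    have : k = 0 := by simp at hk; omega
    subst this
    simp [(h.2 s).1, (h.2 t).1]
  | succ n ih =>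
    obtain ⟨e1, e2⟩ := ih (fun k hk => hn k (by omega))
    have e4 := hn n (by omega)
    rw [show s+(n+1) = s+n+1 by omega] at *
    rw [show t+(n+1) = t+n+1 by omega] at *
    obtain ⟨a1, a2, a3⟩ := h.2 (s+n)
    obtain ⟨b1, b2, b3⟩ := h.2 (t+n)
    have e3 : p (s+n+1) + p t = p (t+n+1) + p s := by
      rw [a3, b3, e4]
      split_ifs <;> omega
    refine ⟨e3, ?_⟩
    intro k hk
    by_cases k1 : p s + k ≤ p (s+n)
    · exact e2 k k1
    by_cases k2 : p s + k = p (s+n) + 1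
    · rw [k2, show p t + k = p (t+n) + 1 by omega, a2, b2, e4]
    · have k3 : p s + k = p (s+n+1) := by split_ifs at a3 <;> omega
      rw [k3, show p t + k = p (t+n+1) by omega, (h.2 _).1, (h.2 _).1]

lemma LRel.down (h : LRel α v w p) (hw : ∀ n, Good w n) (n : ℕ) : Good v n := by
  intro i j hij hk k hkn
  have hi := h.lt i
  have hj := h.lt j
  have hwi := h.pred i (p (i+1) - 1) (by omega)
  have hwj := h.pred j (p (j+1) - 1) (by omega)
  obtain ⟨e1, e2⟩ := h.conv (i+1) (j+1) n hk
  have key := hw (p (i+1+n) + 1 - p (i+1)) (p (i+1) - 1) (p (j+1) - 1) (by rw [hwi, hwj]; exact hij)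
    (by
      intro k hk
      rw [show p (i+1) - 1 + 1 = p (i+1) by omega, show p (j+1) - 1 + 1 = p (j+1) by omega]
      exact e2 k (by omega))
  rw [show p (i+1) - 1 + 1 = p (i+1) by omega] at key
  have hlt : p (i+1+k) < p (i+1+n) := h.mono (by omega)
  have := (h.sync (i+1) 0 (p (i+1+n) + 1 - p (i+1)) (by simpa [h.1] using key) k (by omega)).2
  simpa using this

lemma LRel.up (h : LRel α v w p) (n : ℕ) (hv : ∀ m < n, Good v m) : Good w n := by
  intro i j hij hk
  rcases Nat.eq_zero_or_pos n with rfl | hn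
  · intro k hk; omega
  have hkk := hk 0 hn
  simp at hkk
  have aux : ∀ i, (∃ s, i + 1 = p (s+1)) ∨ (w i = α ∧ w (i+1) ≠ α) := by
    intro i
    rcases h.cover (i+1) with ⟨s, hs⟩ | ⟨s, hs, hs'⟩
    · rcases s with _ | s
      · rw [h.1] at hs; omega
      · exact Or.inl ⟨s, hs⟩
    · right
      rw [hs, (h.2 s).2.1, show i = p s by omega]
      exact ⟨(h.2 s).1, hs'⟩
  rcases aux i with ⟨s, hs⟩ | ⟨hs1, hs2⟩ <;> rcases aux j with ⟨t, ht⟩ | ⟨ht1, ht2⟩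
  · rw [hs, ht] at hk
    rw [hs]
    rw [h.pred s i hs.symm, h.pred t j ht.symm] at hij
    have hex : ∃ m, p (s+1) + n ≤ p (s+1+m) + 1 := ⟨n, by have := h.add_le (s+1) n; omega⟩
    classical
    have hm := Nat.find_spec hex
    have hm' : ∀ q < Nat.find hex, p (s+1+q) + 1 < p (s+1) + n := by
      intro q hq
      have := Nat.find_min hex hq
      omega
    have hmn : Nat.find hex ≤ n - 1 :=
      Nat.find_min' hex (by have := h.add_le (s+1) (n-1); omega)
    set m := Nat.find hex
    have g := hv m (by omega) s t hij (fun q hq => (h.sync (s+1) (t+1) n hk q (hm' q hq)).2)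
    have := (h.conv (s+1) 0 m (by simpa using g)).2
    intro k hk
    have := this k (by omega)
    simpa [h.1] using this
  · rw [← hkk, hs, (h.2 _).1] at ht2; simp at ht2
  · rw [hkk, ht, (h.2 _).1] at hs2; simp at hs2
  · exact absurd (hs1.trans ht1.symm) hij

end

lemma exists_desub {A : Type*} [DecidableEq A] (a b : A)
    (hA : ∀ x : A, x = a ∨ x = b) (w : ℕ → A) (hw : ∀ n, Good w n) :
    ∃ v p, LRel (w 0) v w p := by
  have hbin : ∀ x y z : A, x ≠ z → y ≠ z → x = y := by
    intro x y z h1 h2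
    rcases hA x with rfl | rfl <;> rcases hA y with rfl | rfl <;> rcases hA z with rfl | rfl <;>
      simp_all
  have hno : ∀ i, w i ≠ w 0 → w (i+1) = w 0 := by
    intro i hi
    by_contra hi1
    classical
    have hex : ∃ i, w i ≠ w 0 := ⟨i, hi⟩
    have h1 := Nat.find_spec hex
    have h2 : ∀ q < Nat.find hex, w q = w 0 := by
      intro q hq
      have := Nat.find_min hex hq
      simpa using this
    set m := Nat.find hex
    have hm : m ≠ 0 := by intro h; rw [h] at h1; exact h1 rfl
    have hj := h2 (m-1) (by omega)
    have := hw 1 i (m-1) (by rw [hj]; exact hi) (by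
      intro k hk
      have : k = 0 := by omega
      subst this
      rw [show m - 1 + 1 + 0 = m by omega]
      exact hbin _ _ (w 0) hi1 h1) 0 (by omega)
    exact hi1 this
  let p : ℕ → ℕ := fun n => Nat.rec 0 (fun _ q => if w (q+1) = w 0 then q + 1 else q + 2) n
  have hp : ∀ n, p (n+1) = if w (p n + 1) = w 0 then p n + 1 else p n + 2 := fun n => rfl
  have hα : ∀ n, w (p n) = w 0 := by
    intro n
    induction n with
    | zero => rfl
    | succ n ih =>
      rw [hp]
      split_ifs with h
      · exact h
      · exact hno _ h
  exact ⟨fun n => w (p n + 1), p, rfl, fun n => ⟨hα n, rfl, hp n⟩⟩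

theorem binary_lsp_iff_L_adic {A : Type*} [DecidableEq A] (a b : A) (hab : a ≠ b)
    (hA : ∀ x : A, x = a ∨ x = b) (w : ℕ → A) :
    IsLSP w ↔ ∃ ws : ℕ → (ℕ → A), ws 0 = w ∧
      ∀ n : ℕ, ∃ α : A, InfImage (Lmor α) (ws (n + 1)) (ws n) := by
  rw [isLSP_iff_good]
  simp only [infImage_iff]
  constructor
  · intro hw
    have step : ∀ x : {x : ℕ → A // ∀ n, Good x n}, ∃ y : {x : ℕ → A // ∀ n, Good x n},
        ∃ α p, LRel α y.1 x.1 p := by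
      rintro ⟨x, hx⟩
      obtain ⟨v, p, h⟩ := exists_desub a b hA x hx
      exact ⟨⟨v, h.down hx⟩, x 0, p, h⟩
    choose f hf using step
    refine ⟨fun n => (f^[n] ⟨w, hw⟩).1, rfl, ?_⟩
    intro n
    simp only [Function.iterate_succ_apply']
    exact hf _
  · rintro ⟨ws, rfl, hws⟩ n
    have : ∀ n m, Good (ws m) n := by
      intro n
      induction n using Nat.strong_induction_on with
      | _ n ih =>
        intro m
        obtain ⟨α, p, h⟩ := hws m
        exact h.up n (fun k hk => ih k hk (m+1))
    exact this n 0
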